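/- Fix integers n ≥ 1, v > 0, and k₁, k₂ ≥ n. Then the space H_{n,v}(k₁,k₂) of pluriharmonic polynomials inside Q_{n,v}(2) is one-dimensional over ℂ; equivalently, up to rescaling there is a unique pluriharmonic polynomial in Q_{n,v}(2). -/

import Mathlib

noncomputable section

/-- Variables for polynomials in the entries of two `n × n` matrices `W` (`Sum.inl`) and
`Z` (`Sum.inr`). -/
abbrev WZVars (n : ℕ) := (Fin n × Fin n) ⊕ (Fin n × Fin n)

/-- The polynomial `Q_a(W,Z)` defined by `det(W + λ Z) = Σ_a Q_a(W,Z) λ^a`. -/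
def Qpoly (n a : ℕ) : MvPolynomial (WZVars n) ℂ :=
  Polynomial.coeff
    (Matrix.det (Matrix.of fun s t : Fin n =>
      Polynomial.C (MvPolynomial.X (Sum.inl (s, t))) +
        Polynomial.X * Polynomial.C (MvPolynomial.X (Sum.inr (s, t))))) a

/-- The substitution `Q(W,Z) ↦ Q(A W ᵗB, A Z ᵗB)` on polynomials. -/
def substWZ {n : ℕ} (A B : Matrix (Fin n) (Fin n) ℂ) :
    MvPolynomial (WZVars n) ℂ →ₐ[ℂ] MvPolynomial (WZVars n) ℂ :=
  MvPolynomial.aeval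
    (Sum.elim
      (fun st : Fin n × Fin n =>
        ∑ p : Fin n, ∑ q : Fin n,
          MvPolynomial.C (A st.1 p * B st.2 q) * MvPolynomial.X (Sum.inl (p, q)))
      (fun st : Fin n × Fin n =>
        ∑ p : Fin n, ∑ q : Fin n,
          MvPolynomial.C (A st.1 p * B st.2 q) * MvPolynomial.X (Sum.inr (p, q))))

/-- Membership in `Q_{n,v}(2)`: `Q(A W ᵗB, A Z ᵗB) = det(A)^v det(B)^v Q(W,Z)` for all
invertible `A, B`. -/
def MemQ (n v : ℕ) (Q : MvPolynomial (WZVars n) ℂ) : Prop :=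
  ∀ A B : Matrix (Fin n) (Fin n) ℂ, IsUnit A.det → IsUnit B.det →
    substWZ A B Q = MvPolynomial.C (A.det ^ v * B.det ^ v) * Q

/-- The space `Q_{n,v}(2)`, as a ℂ-submodule of the polynomial ring. -/
def QSub (n v : ℕ) : Submodule ℂ (MvPolynomial (WZVars n) ℂ) where
  carrier := {Q | MemQ n v Q}
  zero_mem' := by intro A B hA hB; simp
  add_mem' := by
    intro a b ha hb A B hA hB
    simp [map_add, ha A B hA hB, hb A B hA hB, mul_add]
  smul_mem' := by
    intro c Q hQ A B hA hB
    simp [map_smul, hQ A B hA hB, mul_smul_comm]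

/-- Combined column index for an `n × (k₁ + k₂)` matrix split into blocks of `k₁` and `k₂`
columns. -/
abbrev Cols (k₁ k₂ : ℕ) := Fin k₁ ⊕ Fin k₂

/-- Variables for polynomials `P(X,Y)` in the entries of two `n × (k₁+k₂)` matrices:
`Sum.inl (s,u)` is `x_{s,u}` and `Sum.inr (s,u)` is `y_{s,u}`. -/
abbrev XYVars (n k₁ k₂ : ℕ) := (Fin n × Cols k₁ k₂) ⊕ (Fin n × Cols k₁ k₂)

/-- The polynomial `P(X,Y) = Q(X₁ ᵗY₁, X₂ ᵗY₂)` associated to `Q(W,Z)`, where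
`X = (X₁, X₂)`, `Y = (Y₁, Y₂)` with `X_i, Y_i ∈ M_{n,k_i}(ℂ)`. -/
def toP2 {n : ℕ} (k₁ k₂ : ℕ) (Q : MvPolynomial (WZVars n) ℂ) :
    MvPolynomial (XYVars n k₁ k₂) ℂ :=
  MvPolynomial.aeval
    (Sum.elim
      (fun st : Fin n × Fin n =>
        ∑ u : Fin k₁,
          MvPolynomial.X (Sum.inl (st.1, Sum.inl u)) *
            MvPolynomial.X (Sum.inr (st.2, Sum.inl u)))
      (fun st : Fin n × Fin n =>
        ∑ u : Fin k₂,
          MvPolynomial.X (Sum.inl (st.1, Sum.inr u)) *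
            MvPolynomial.X (Sum.inr (st.2, Sum.inr u)))) Q

/-- The operator `Δ_{s,t} = Σ_{u=1}^{k₁+k₂} ∂²/(∂x_{s,u} ∂y_{t,u})`. -/
def Delta {n k₁ k₂ : ℕ} (s t : Fin n) (P : MvPolynomial (XYVars n k₁ k₂) ℂ) :
    MvPolynomial (XYVars n k₁ k₂) ℂ :=
  ∑ u : Cols k₁ k₂,
    MvPolynomial.pderiv (Sum.inl (s, u)) (MvPolynomial.pderiv (Sum.inr (t, u)) P)

/-- `P` is pluriharmonic if `Δ_{s,t} P = 0` for all `s, t`. -/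
def Pluriharmonic {n k₁ k₂ : ℕ} (P : MvPolynomial (XYVars n k₁ k₂) ℂ) : Prop :=
  ∀ s t : Fin n, Delta s t P = 0

/-- `Δ_{s,t}` is additive. -/
lemma Delta_add {n k₁ k₂ : ℕ} (s t : Fin n) (P P' : MvPolynomial (XYVars n k₁ k₂) ℂ) :
    Delta s t (P + P') = Delta s t P + Delta s t P' := by
  simp only [Delta, map_add, Finset.sum_add_distrib]

/-- `Δ_{s,t}` commutes with scalars. -/
lemma Delta_smul {n k₁ k₂ : ℕ} (s t : Fin n) (c : ℂ) (P : MvPolynomial (XYVars n k₁ k₂) ℂ) :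
    Delta s t (c • P) = c • Delta s t P := by
  simp only [Delta, Derivation.map_smul, map_smul, Finset.smul_sum]

lemma toP2_add {n : ℕ} (k₁ k₂ : ℕ) (a b : MvPolynomial (WZVars n) ℂ) :
    toP2 k₁ k₂ (a + b) = toP2 k₁ k₂ a + toP2 k₁ k₂ b := by
  simp only [toP2, map_add]

lemma toP2_smul {n : ℕ} (k₁ k₂ : ℕ) (c : ℂ) (a : MvPolynomial (WZVars n) ℂ) :
    toP2 k₁ k₂ (c • a) = c • toP2 k₁ k₂ a := by
  simp only [toP2, map_smul]

/-- The space `H_{n,v}(k₁,k₂) ⊆ Q_{n,v}(2)` of those `Q` whose associated polynomial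
`P(X,Y) = Q(X₁ ᵗY₁, X₂ ᵗY₂)` is pluriharmonic, as a ℂ-submodule. -/
def HSubspace (n v k₁ k₂ : ℕ) : Submodule ℂ (MvPolynomial (WZVars n) ℂ) where
  carrier := {Q | MemQ n v Q ∧ Pluriharmonic (toP2 k₁ k₂ Q)}
  zero_mem' := by
    refine ⟨(QSub n v).zero_mem, fun s t => ?_⟩
    simp [Delta, toP2]
  add_mem' := by
    intro a b ha hb
    exact ⟨(QSub n v).add_mem ha.1 hb.1, fun s t => by
      rw [toP2_add, Delta_add, ha.2 s t, hb.2 s t, add_zero]⟩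
  smul_mem' := by
    intro c Q hQ
    exact ⟨(QSub n v).smul_mem c hQ.1, fun s t => by
      rw [toP2_smul, Delta_smul, hQ.2 s t, smul_zero]⟩

section helpers
open MvPolynomial

def fwt {σ : Type*} (m : σ →₀ ℕ) : ℂ := ((m.prod fun _ k => k.factorial : ℕ) : ℂ)

def fisch {σ : Type*} (f g : MvPolynomial σ ℂ) : ℂ :=
  ∑ m ∈ f.support, fwt m * (starRingEnd ℂ) (coeff m f) * coeff m g

lemma fisch_eq {σ : Type*} (f g : MvPolynomial σ ℂ) (S : Finset (σ →₀ ℕ)) (h : f.support ⊆ S) :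
    fisch f g = ∑ m ∈ S, fwt m * (starRingEnd ℂ) (coeff m f) * coeff m g := by
  refine Finset.sum_subset h fun m _ hm => ?_
  rw [notMem_support_iff.mp hm]; simp

lemma fisch_add_left {σ : Type*} (f f' g : MvPolynomial σ ℂ) :
    fisch (f + f') g = fisch f g + fisch f' g := by
  classical
  rw [fisch_eq (f + f') g _ support_add, fisch_eq f g _ Finset.subset_union_left,
    fisch_eq f' g _ Finset.subset_union_right, ← Finset.sum_add_distrib]
  refine Finset.sum_congr rfl fun m _ => ?_
  rw [coeff_add, map_add]; ring

lemma fisch_zero_left {σ : Type*} (g : MvPolynomial σ ℂ) : fisch 0 g = 0 := by simp [fisch]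

lemma fisch_zero_right {σ : Type*} (g : MvPolynomial σ ℂ) : fisch g 0 = 0 := by simp [fisch]

lemma fisch_add_right {σ : Type*} (f g g' : MvPolynomial σ ℂ) :
    fisch f (g + g') = fisch f g + fisch f g' := by
  simp only [fisch, coeff_add, mul_add, Finset.sum_add_distrib]

lemma fisch_sum_left {σ ι : Type*} (S : Finset ι) (f : ι → MvPolynomial σ ℂ)
    (g : MvPolynomial σ ℂ) : fisch (∑ i ∈ S, f i) g = ∑ i ∈ S, fisch (f i) g := by
  classical
  induction S using Finset.induction_on with
  | empty => simp [fisch_zero_left]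
  | insert a s ha ih => rw [Finset.sum_insert ha, Finset.sum_insert ha, fisch_add_left, ih]

lemma fisch_sum_right {σ ι : Type*} (S : Finset ι) (f : ι → MvPolynomial σ ℂ)
    (g : MvPolynomial σ ℂ) : fisch g (∑ i ∈ S, f i) = ∑ i ∈ S, fisch g (f i) := by
  classical
  induction S using Finset.induction_on with
  | empty => simp [fisch_zero_right]
  | insert a s ha ih => rw [Finset.sum_insert ha, Finset.sum_insert ha, fisch_add_right, ih]

lemma fisch_monomial {σ : Type*} (m : σ →₀ ℕ) (c : ℂ) (g : MvPolynomial σ ℂ) :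
    fisch (monomial m c) g = fwt m * (starRingEnd ℂ) c * coeff m g := by
  classical
  rw [fisch_eq _ g {m} support_monomial_subset]
  simp

lemma fwt_add_single {σ : Type*} (m : σ →₀ ℕ) (i : σ) :
    fwt (m + Finsupp.single i 1) = fwt m * (m i + 1) := by
  classical
  have h : ∀ S : Finset σ, m.support ⊆ S →
      m.prod (fun _ k => k.factorial) = ∏ j ∈ S, (m j).factorial := fun S hS =>
    Finsupp.prod_of_support_subset _ hS _ (by simp)
  have h1 := h (insert i m.support) (Finset.subset_insert _ _)
  have h2 : (m + Finsupp.single i 1).prod (fun _ k => k.factorial)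
      = ∏ j ∈ insert i m.support, ((m + Finsupp.single i 1 : σ →₀ ℕ) j).factorial := by
    refine Finsupp.prod_of_support_subset _ ?_ _ (by simp)
    intro j hj
    by_cases hji : j = i
    · simp [hji]
    · simp [Finsupp.single_apply, Ne.symm hji] at hj
      simp [hj]
  have h3 : ∀ j, ((m + Finsupp.single i 1 : σ →₀ ℕ) j).factorial
      = (m j).factorial * (if j = i then m i + 1 else 1) := by
    intro j
    by_cases hji : j = i
    · subst hji; simp [Nat.factorial_succ, mul_comm]
    · simp [Finsupp.single_apply, hji]
  unfold fwt
  rw [h2, h1]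
  simp_rw [h3]
  rw [Finset.prod_mul_distrib, Finset.prod_ite_eq' _ i]
  simp

lemma fisch_X_mul {σ : Type*} (i : σ) (f g : MvPolynomial σ ℂ) :
    fisch (X i * f) g = fisch f (pderiv i g) := by
  induction f using MvPolynomial.induction_on' with
  | monomial m c =>
    rw [show X i * monomial m c = monomial (m + Finsupp.single i 1) c by
      rw [X, monomial_mul, one_mul, add_comm]]
    rw [fisch_monomial, fisch_monomial, fwt_add_single, coeff_pderiv]
    ring
  | add p q hp hq => rw [mul_add, fisch_add_left, fisch_add_left, hp, hq]

lemma fwt_pos {σ : Type*} (m : σ →₀ ℕ) : ∃ r : ℝ, 0 < r ∧ fwt m = r :=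
  ⟨((m.prod fun _ k => k.factorial : ℕ) : ℝ), by
    norm_cast; exact Finset.prod_pos fun j _ => Nat.factorial_pos _, by
      rw [fwt, Complex.ofReal_natCast]⟩

lemma fisch_self_re {σ : Type*} (f : MvPolynomial σ ℂ) : 0 ≤ (fisch f f).re := by
  rw [fisch, Complex.re_sum]
  refine Finset.sum_nonneg fun m _ => ?_
  obtain ⟨r, hr, h⟩ := fwt_pos m
  rw [h, mul_assoc, ← Complex.normSq_eq_conj_mul_self, ← Complex.ofReal_mul, Complex.ofReal_re]
  exact mul_nonneg hr.le (Complex.normSq_nonneg _)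

lemma fisch_self_eq_zero {σ : Type*} (f : MvPolynomial σ ℂ) (h0 : (fisch f f).re = 0) : f = 0 := by
  rw [fisch, Complex.re_sum, Finset.sum_eq_zero_iff_of_nonneg] at h0
  · ext m
    by_contra hm
    have := h0 m (mem_support_iff.mpr hm)
    obtain ⟨r, hr, h⟩ := fwt_pos m
    rw [h, mul_assoc, ← Complex.normSq_eq_conj_mul_self, ← Complex.ofReal_mul,
      Complex.ofReal_re] at this
    rcases mul_eq_zero.mp this with h | h
    · exact hr.ne' h
    · exact hm (Complex.normSq_eq_zero.mp h)
  · intro m _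
    obtain ⟨r, hr, h⟩ := fwt_pos m
    rw [h, mul_assoc, ← Complex.normSq_eq_conj_mul_self, ← Complex.ofReal_mul, Complex.ofReal_re]
    exact mul_nonneg hr.le (Complex.normSq_nonneg _)

lemma chain {σ τ : Type*} [Fintype τ] (f : τ → MvPolynomial σ ℂ) (i : σ) (Q : MvPolynomial τ ℂ) :
    pderiv i (aeval f Q) = ∑ j, pderiv i (f j) * aeval f (pderiv j Q) := by
  classical
  induction Q using MvPolynomial.induction_on with
  | C a => simp [algebraMap_eq]
  | add p q hp hq =>
    rw [map_add, map_add, hp, hq, ← Finset.sum_add_distrib]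
    exact Finset.sum_congr rfl fun j _ => by rw [map_add, map_add, mul_add]
  | mul_X p k hp =>
    rw [map_mul, aeval_X, pderiv_mul, hp, Finset.sum_mul]
    have h : ∀ j, pderiv i (f j) * aeval f (pderiv j (p * X k)) =
        pderiv i (f j) * aeval f (pderiv j p) * f k +
          (if j = k then aeval f p * pderiv i (f k) else 0) := by
      intro j
      rw [pderiv_mul, map_add, map_mul, map_mul, aeval_X, pderiv_X]
      by_cases hj : j = k
      · subst hj; rw [Pi.single_eq_same, map_one, if_pos rfl]; ring
      · rw [Pi.single_eq_of_ne (Ne.symm hj), map_zero, if_neg hj]; ring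
    rw [Finset.sum_congr rfl fun j _ => h j, Finset.sum_add_distrib]
    simp


def gW (n k₁ k₂ : ℕ) : WZVars n → MvPolynomial (XYVars n k₁ k₂) ℂ :=
    (Sum.elim
      (fun st : Fin n × Fin n =>
        ∑ u : Fin k₁,
          MvPolynomial.X (Sum.inl (st.1, Sum.inl u)) *
            MvPolynomial.X (Sum.inr (st.2, Sum.inl u)))
      (fun st : Fin n × Fin n =>
        ∑ u : Fin k₂,
          MvPolynomial.X (Sum.inl (st.1, Sum.inr u)) *
            MvPolynomial.X (Sum.inr (st.2, Sum.inr u))))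

def phi (n k₁ k₂ : ℕ) : MvPolynomial (WZVars n) ℂ →ₐ[ℂ] MvPolynomial (XYVars n k₁ k₂) ℂ :=
  aeval (gW n k₁ k₂)

lemma toP2_eq {n : ℕ} (k₁ k₂ : ℕ) (Q : MvPolynomial (WZVars n) ℂ) :
    toP2 k₁ k₂ Q = phi n k₁ k₂ Q := rfl

lemma phi_X {n k₁ k₂ : ℕ} (i : WZVars n) : phi n k₁ k₂ (X i) = gW n k₁ k₂ i := by
  rw [phi, aeval_X]

lemma phi_inj {n k₁ k₂ : ℕ} (hk₁ : n ≤ k₁) (hk₂ : n ≤ k₂) :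
    Function.Injective (phi n k₁ k₂) := by
  classical
  let ρ : MvPolynomial (XYVars n k₁ k₂) ℂ →ₐ[ℂ] MvPolynomial (WZVars n) ℂ :=
    aeval (Sum.elim
      (fun p : Fin n × Cols k₁ k₂ => Sum.elim
        (fun u : Fin k₁ => if h : u.1 < n then X (Sum.inl (p.1, ⟨u.1, h⟩)) else 0)
        (fun u : Fin k₂ => if h : u.1 < n then X (Sum.inr (p.1, ⟨u.1, h⟩)) else 0) p.2)
      (fun p : Fin n × Cols k₁ k₂ => Sum.elim
        (fun u : Fin k₁ => if u = Fin.castLE hk₁ p.1 then 1 else 0)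
        (fun u : Fin k₂ => if u = Fin.castLE hk₂ p.1 then 1 else 0) p.2))
  have : ρ.comp (phi n k₁ k₂) = AlgHom.id ℂ _ := by
    apply MvPolynomial.algHom_ext
    rintro (⟨a, b⟩ | ⟨a, b⟩)
    · rw [AlgHom.comp_apply, phi_X]
      simp only [gW, Sum.elim_inl, map_sum, map_mul, ρ, aeval_X, Sum.elim_inr]
      simp
    · rw [AlgHom.comp_apply, phi_X]
      simp only [gW, Sum.elim_inl, map_sum, map_mul, ρ, aeval_X, Sum.elim_inr]
      simp
  intro x y hxy
  have h := congrArg ρ hxy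
  rw [← AlgHom.comp_apply, ← AlgHom.comp_apply, this] at h
  exact h

section
variable {n k₁ k₂ : ℕ}

lemma pdX {σ : Type*} [DecidableEq σ] (i j : σ) :
    pderiv i (X j : MvPolynomial σ ℂ) = if j = i then 1 else 0 := by
  rw [pderiv_X, Pi.single_apply]

lemma chain_phi (i : XYVars n k₁ k₂) (Q : MvPolynomial (WZVars n) ℂ) :
    pderiv i (phi n k₁ k₂ Q) =
      ∑ j, pderiv i (gW n k₁ k₂ j) * phi n k₁ k₂ (pderiv j Q) := chain _ _ _

lemma dY1 (t : Fin n) (u : Fin k₁) (Q : MvPolynomial (WZVars n) ℂ) :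
    pderiv (Sum.inr (t, Sum.inl u)) (phi n k₁ k₂ Q) =
      ∑ a, X (Sum.inl (a, Sum.inl u)) * phi n k₁ k₂ (pderiv (Sum.inl (a, t)) Q) := by
  classical
  rw [chain_phi, Fintype.sum_sum_type, Fintype.sum_prod_type, Fintype.sum_prod_type]
  simp [gW, Pi.single_apply, Prod.ext_iff, ite_and]

lemma dX1 (s : Fin n) (u : Fin k₁) (Q : MvPolynomial (WZVars n) ℂ) :
    pderiv (Sum.inl (s, Sum.inl u)) (phi n k₁ k₂ Q) =
      ∑ b, X (Sum.inr (b, Sum.inl u)) * phi n k₁ k₂ (pderiv (Sum.inl (s, b)) Q) := by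
  classical
  rw [chain_phi, Fintype.sum_sum_type, Fintype.sum_prod_type, Fintype.sum_prod_type]
  simp [gW, Pi.single_apply, Prod.ext_iff, ite_and]

lemma dY2 (t : Fin n) (u : Fin k₂) (Q : MvPolynomial (WZVars n) ℂ) :
    pderiv (Sum.inr (t, Sum.inr u)) (phi n k₁ k₂ Q) =
      ∑ a, X (Sum.inl (a, Sum.inr u)) * phi n k₁ k₂ (pderiv (Sum.inr (a, t)) Q) := by
  classical
  rw [chain_phi, Fintype.sum_sum_type, Fintype.sum_prod_type, Fintype.sum_prod_type]
  simp [gW, Pi.single_apply, Prod.ext_iff, ite_and]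

lemma dX2 (s : Fin n) (u : Fin k₂) (Q : MvPolynomial (WZVars n) ℂ) :
    pderiv (Sum.inl (s, Sum.inr u)) (phi n k₁ k₂ Q) =
      ∑ b, X (Sum.inr (b, Sum.inr u)) * phi n k₁ k₂ (pderiv (Sum.inr (s, b)) Q) := by
  classical
  rw [chain_phi, Fintype.sum_sum_type, Fintype.sum_prod_type, Fintype.sum_prod_type]
  simp [gW, Pi.single_apply, Prod.ext_iff, ite_and]
end

section
variable {n : ℕ}

lemma rot {α β γ M : Type*} [Fintype α] [Fintype β] [Fintype γ] [AddCommMonoid M]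
    (f : γ → α → β → M) : ∑ u, ∑ a, ∑ b, f u a b = ∑ a, ∑ b, ∑ u, f u a b := by
  rw [Finset.sum_comm]
  exact Finset.sum_congr rfl fun a _ => Finset.sum_comm

lemma rot4 {α β γ δ M : Type*} [Fintype α] [Fintype β] [Fintype γ] [Fintype δ] [AddCommMonoid M]
    (f : α → β → γ → δ → M) :
    ∑ p, ∑ q, ∑ s, ∑ t, f p q s t = ∑ s, ∑ t, ∑ p, ∑ q, f p q s t :=
  (Finset.sum_congr rfl fun _ _ => rot _).trans (rot _)

def Dop (k₁ k₂ : ℕ) (s t : Fin n) (Q : MvPolynomial (WZVars n) ℂ) : MvPolynomial (WZVars n) ℂ :=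
  ((k₁ : MvPolynomial (WZVars n) ℂ) * pderiv (Sum.inl (s, t)) Q +
    ∑ a, ∑ b, X (Sum.inl (a, b)) * pderiv (Sum.inl (s, b)) (pderiv (Sum.inl (a, t)) Q)) +
  ((k₂ : MvPolynomial (WZVars n) ℂ) * pderiv (Sum.inr (s, t)) Q +
    ∑ a, ∑ b, X (Sum.inr (a, b)) * pderiv (Sum.inr (s, b)) (pderiv (Sum.inr (a, t)) Q))

lemma phi_Dop (k₁ k₂ : ℕ) (s t : Fin n) (Q : MvPolynomial (WZVars n) ℂ) :
    phi n k₁ k₂ (Dop k₁ k₂ s t Q) = Delta s t (phi n k₁ k₂ Q) := by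
  classical
  have h1 : ∀ u : Fin k₁, pderiv (Sum.inl (s, Sum.inl u))
      (pderiv (Sum.inr (t, Sum.inl u)) (phi n k₁ k₂ Q)) =
      phi n k₁ k₂ (pderiv (Sum.inl (s, t)) Q) + ∑ a, ∑ b, X (Sum.inl (a, Sum.inl u)) *
        X (Sum.inr (b, Sum.inl u)) *
          phi n k₁ k₂ (pderiv (Sum.inl (s, b)) (pderiv (Sum.inl (a, t)) Q)) := by
    intro u
    rw [dY1, map_sum]
    simp only [pderiv_mul, dX1, Finset.sum_add_distrib, Finset.mul_sum, mul_assoc]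
    congr 1
    simp [Pi.single_apply, Prod.ext_iff]
  have h2 : ∀ u : Fin k₂, pderiv (Sum.inl (s, Sum.inr u))
      (pderiv (Sum.inr (t, Sum.inr u)) (phi n k₁ k₂ Q)) =
      phi n k₁ k₂ (pderiv (Sum.inr (s, t)) Q) + ∑ a, ∑ b, X (Sum.inl (a, Sum.inr u)) *
        X (Sum.inr (b, Sum.inr u)) *
          phi n k₁ k₂ (pderiv (Sum.inr (s, b)) (pderiv (Sum.inr (a, t)) Q)) := by
    intro u
    rw [dY2, map_sum]
    simp only [pderiv_mul, dX2, Finset.sum_add_distrib, Finset.mul_sum, mul_assoc]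
    congr 1
    simp [Pi.single_apply, Prod.ext_iff]
  rw [Delta, Fintype.sum_sum_type]
  simp only [h1, h2, Finset.sum_add_distrib, Dop, map_add, map_sum, map_mul, phi_X, map_natCast,
    gW, Sum.elim_inl, Sum.elim_inr, Finset.sum_mul]
  congr 1
  · congr 1
    · simp
    · exact (rot _).symm
  · congr 1
    · simp
    · exact (rot _).symm

def sig (n k₁ k₂ : ℕ) (A B : Matrix (Fin n) (Fin n) ℂ) :
    MvPolynomial (XYVars n k₁ k₂) ℂ →ₐ[ℂ] MvPolynomial (XYVars n k₁ k₂) ℂ :=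
  aeval (Sum.elim
    (fun p => ∑ q, C (A p.1 q) * X (Sum.inl (q, p.2)))
    (fun p => ∑ q, C (B p.1 q) * X (Sum.inr (q, p.2))))

variable {k₁ k₂ : ℕ} (A B : Matrix (Fin n) (Fin n) ℂ)

lemma sig_X1 (p : Fin n × Cols k₁ k₂) : sig n k₁ k₂ A B (X (Sum.inl p)) =
    ∑ q, C (A p.1 q) * X (Sum.inl (q, p.2)) := by
  rw [sig, aeval_X, Sum.elim_inl]

lemma sig_X2 (p : Fin n × Cols k₁ k₂) : sig n k₁ k₂ A B (X (Sum.inr p)) =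
    ∑ q, C (B p.1 q) * X (Sum.inr (q, p.2)) := by
  rw [sig, aeval_X, Sum.elim_inr]

lemma sig_dX (s : Fin n) (u : Cols k₁ k₂) (P : MvPolynomial (XYVars n k₁ k₂) ℂ) :
    pderiv (Sum.inl (s, u)) (sig n k₁ k₂ A B P) =
      ∑ p, C (A p s) * sig n k₁ k₂ A B (pderiv (Sum.inl (p, u)) P) := by
  classical
  have := chain (Sum.elim
    (fun p => ∑ q, C (A p.1 q) * X (Sum.inl (q, p.2)))
    (fun p => ∑ q, C (B p.1 q) * X (Sum.inr (q, p.2)))) (Sum.inl (s, u)) P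
  rw [← sig] at this
  rw [this, Fintype.sum_sum_type, Fintype.sum_prod_type]
  simp only [Sum.elim_inl, Sum.elim_inr, map_sum, pderiv_C_mul, pdX, Sum.inl.injEq, reduceCtorEq,
    Prod.ext_iff, ite_and]
  simp

lemma sig_dY (s : Fin n) (u : Cols k₁ k₂) (P : MvPolynomial (XYVars n k₁ k₂) ℂ) :
    pderiv (Sum.inr (s, u)) (sig n k₁ k₂ A B P) =
      ∑ p, C (B p s) * sig n k₁ k₂ A B (pderiv (Sum.inr (p, u)) P) := by
  classical
  have := chain (Sum.elim
    (fun p => ∑ q, C (A p.1 q) * X (Sum.inl (q, p.2)))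
    (fun p => ∑ q, C (B p.1 q) * X (Sum.inr (q, p.2)))) (Sum.inr (s, u)) P
  rw [← sig] at this
  rw [this, Fintype.sum_sum_type, Fintype.sum_prod_type, Fintype.sum_prod_type]
  simp only [Sum.elim_inl, Sum.elim_inr, map_sum, pderiv_C_mul, pdX, Sum.inr.injEq, reduceCtorEq,
    Prod.ext_iff, ite_and]
  simp

lemma sig_Delta (s t : Fin n) (P : MvPolynomial (XYVars n k₁ k₂) ℂ) :
    Delta s t (sig n k₁ k₂ A B P) =
      ∑ p, ∑ q, C (A p s * B q t) * sig n k₁ k₂ A B (Delta p q P) := by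
  simp only [Delta, sig_dY, map_sum, pderiv_C_mul, sig_dX, Finset.mul_sum]
  rw [rot, Finset.sum_comm]
  refine Finset.sum_congr rfl fun p _ => Finset.sum_congr rfl fun q _ =>
    Finset.sum_congr rfl fun u _ => ?_
  rw [C_mul]; ring

lemma phi_subst (Q : MvPolynomial (WZVars n) ℂ) :
    phi n k₁ k₂ (substWZ A B Q) = sig n k₁ k₂ A B (phi n k₁ k₂ Q) := by
  rw [← AlgHom.comp_apply, ← AlgHom.comp_apply]
  congr 1
  apply MvPolynomial.algHom_ext
  rintro (⟨a, b⟩ | ⟨a, b⟩)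
  · rw [AlgHom.comp_apply, AlgHom.comp_apply, phi_X, substWZ, aeval_X]
    simp only [gW, Sum.elim_inl, map_sum, map_mul, phi_X, sig_X1, sig_X2, algHom_C, algebraMap_eq,
      Finset.sum_mul, Finset.mul_sum]
    rw [rot, Finset.sum_comm]
    refine Finset.sum_congr rfl fun p _ => Finset.sum_congr rfl fun q _ =>
      Finset.sum_congr rfl fun u _ => ?_
    ring
  · rw [AlgHom.comp_apply, AlgHom.comp_apply, phi_X, substWZ, aeval_X]
    simp only [gW, Sum.elim_inr, map_sum, map_mul, phi_X, sig_X1, sig_X2, algHom_C, algebraMap_eq,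
      Finset.sum_mul, Finset.mul_sum]
    rw [rot, Finset.sum_comm]
    refine Finset.sum_congr rfl fun p _ => Finset.sum_congr rfl fun q _ =>
      Finset.sum_congr rfl fun u _ => ?_
    ring
end

section
variable {n k₁ k₂ : ℕ}

def wz (s t : Fin n) : MvPolynomial (WZVars n) ℂ := X (Sum.inl (s, t)) + X (Sum.inr (s, t))

lemma phi_wz (s t : Fin n) : phi n k₁ k₂ (wz s t) =
    ∑ u : Cols k₁ k₂, X (Sum.inl (s, u)) * X (Sum.inr (t, u)) := by
  rw [wz, map_add, phi_X, phi_X, Fintype.sum_sum_type]; rfl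

lemma fisch_wz (s t : Fin n) (F P : MvPolynomial (XYVars n k₁ k₂) ℂ) :
    fisch (phi n k₁ k₂ (wz s t) * F) P = fisch F (Delta s t P) := by
  rw [phi_wz, Finset.sum_mul, fisch_sum_left, Delta, fisch_sum_right]
  refine Finset.sum_congr rfl fun u _ => ?_
  rw [mul_comm (X _) (X _), mul_assoc, fisch_X_mul, fisch_X_mul]

lemma sig_wz (A B : Matrix (Fin n) (Fin n) ℂ) (p q : Fin n) :
    sig n k₁ k₂ A B (phi n k₁ k₂ (wz p q)) =
      ∑ s, ∑ t, C (A p s * B q t) * phi n k₁ k₂ (wz s t) := by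
  simp only [phi_wz, map_sum, map_mul, sig_X1, sig_X2, Finset.sum_mul, Finset.mul_sum]
  rw [rot, Finset.sum_comm]
  refine Finset.sum_congr rfl fun s _ => Finset.sum_congr rfl fun t _ =>
    Finset.sum_congr rfl fun u _ => ?_
  ring

def Eop (k₁ k₂ : ℕ) : MvPolynomial (WZVars n) ℂ →ₗ[ℂ] MvPolynomial (WZVars n) ℂ where
  toFun Q := ∑ s, ∑ t, wz s t * Dop k₁ k₂ s t Q
  map_add' Q Q' := by
    simp only [← Finset.sum_add_distrib, ← mul_add]
    refine Finset.sum_congr rfl fun s _ => Finset.sum_congr rfl fun t _ => ?_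
    congr 1
    simp only [Dop, map_add, mul_add, Finset.sum_add_distrib]
    ring
  map_smul' c Q := by
    simp only [Finset.smul_sum, RingHom.id_apply, ← mul_smul_comm]
    refine Finset.sum_congr rfl fun s _ => Finset.sum_congr rfl fun t _ => ?_
    congr 1
    simp only [Dop, Derivation.map_smul, mul_smul_comm, ← Finset.smul_sum, smul_add]

lemma phi_Eop (Q : MvPolynomial (WZVars n) ℂ) : phi n k₁ k₂ (Eop k₁ k₂ Q) =
    ∑ s, ∑ t, phi n k₁ k₂ (wz s t) * Delta s t (phi n k₁ k₂ Q) := by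
  simp only [Eop, LinearMap.coe_mk, AddHom.coe_mk, map_sum, map_mul, phi_Dop]

lemma Eop_subst (hk₁ : n ≤ k₁) (hk₂ : n ≤ k₂) (A B : Matrix (Fin n) (Fin n) ℂ)
    (Q : MvPolynomial (WZVars n) ℂ) :
    substWZ A B (Eop k₁ k₂ Q) = Eop k₁ k₂ (substWZ A B Q) := by
  apply phi_inj hk₁ hk₂
  rw [phi_subst, phi_Eop, phi_Eop, phi_subst]
  simp only [sig_Delta, map_sum, map_mul, sig_wz, Finset.sum_mul, Finset.mul_sum]
  rw [rot4]
  refine Finset.sum_congr rfl fun s _ => Finset.sum_congr rfl fun t _ =>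
    Finset.sum_congr rfl fun p _ => Finset.sum_congr rfl fun q _ => ?_
  ring

lemma Eop_mem {v : ℕ} (hk₁ : n ≤ k₁) (hk₂ : n ≤ k₂) (Q : MvPolynomial (WZVars n) ℂ)
    (hQ : Q ∈ QSub n v) : Eop k₁ k₂ Q ∈ QSub n v := by
  intro A B hA hB
  rw [Eop_subst hk₁ hk₂, hQ A B hA hB, ← smul_eq_C_mul, ← smul_eq_C_mul, map_smul]

lemma harm_of_Eop (Q : MvPolynomial (WZVars n) ℂ) (h : Eop k₁ k₂ Q = 0) :
    Pluriharmonic (toP2 k₁ k₂ Q) := by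
  have h1 : fisch (phi n k₁ k₂ (Eop k₁ k₂ Q)) (phi n k₁ k₂ Q) = 0 := by
    rw [h, map_zero, fisch_zero_left]
  rw [phi_Eop] at h1
  simp only [fisch_sum_left, fisch_wz] at h1
  have h2 := congrArg Complex.re h1
  simp only [Complex.re_sum, Complex.zero_re] at h2
  intro s t
  apply fisch_self_eq_zero
  rw [Finset.sum_eq_zero_iff_of_nonneg
    (fun s _ => Finset.sum_nonneg fun t _ => fisch_self_re _)] at h2
  have h3 := h2 s (Finset.mem_univ _)
  rw [Finset.sum_eq_zero_iff_of_nonneg (fun t _ => fisch_self_re _)] at h3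
  exact h3 t (Finset.mem_univ _)

/-- point `(W,-W)` -/
def pt (W : Matrix (Fin n) (Fin n) ℂ) : WZVars n → ℂ :=
  Sum.elim (fun p => W p.1 p.2) (fun p => - W p.1 p.2)

lemma eval_subst (A : Matrix (Fin n) (Fin n) ℂ) (Q : MvPolynomial (WZVars n) ℂ) :
    eval (pt 1) (substWZ A 1 Q) = eval (pt A) Q := by
  rw [← coe_aeval_eq_eval, ← coe_aeval_eq_eval]
  change ((aeval (pt 1)).comp (substWZ A 1)) Q = aeval (pt A) Q
  congr 1
  apply MvPolynomial.algHom_ext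
  rintro (⟨a, b⟩ | ⟨a, b⟩)
  · rw [AlgHom.comp_apply, substWZ, aeval_X, aeval_X]
    simp [pt, Matrix.one_apply]
  · rw [AlgHom.comp_apply, substWZ, aeval_X, aeval_X]
    simp [pt, Matrix.one_apply]

lemma eval_Eop (Q : MvPolynomial (WZVars n) ℂ) (W : Matrix (Fin n) (Fin n) ℂ) :
    eval (pt W) (Eop k₁ k₂ Q) = 0 := by
  simp [Eop, wz, pt]

def psi (n : ℕ) : MvPolynomial (WZVars n) ℂ →ₐ[ℂ] MvPolynomial (Fin n × Fin n) ℂ :=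
  aeval (Sum.elim (fun p => X p) (fun p => - X p))

lemma psi_zero {v : ℕ} (Q : MvPolynomial (WZVars n) ℂ) (hQ : Q ∈ QSub n v)
    (h : eval (pt 1) Q = 0) : psi n Q = 0 := by
  have h0 : (Matrix.mvPolynomialX (Fin n) (Fin n) ℂ).det * psi n Q = 0 := by
    apply MvPolynomial.funext
    intro x
    rw [map_mul, Matrix.eval_det_mvPolynomialX, map_zero]
    by_cases hd : (Matrix.of fun i j => x (i, j)).det = 0
    · rw [hd, zero_mul]
    · have h1 := hQ (Matrix.of fun i j => x (i, j)) 1 (isUnit_iff_ne_zero.mpr hd) (by simp)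
      have h2 := congrArg (eval (pt 1)) h1
      rw [eval_subst, map_mul, h, mul_zero] at h2
      have h3 : eval x (psi n Q) = eval (pt (Matrix.of fun i j => x (i, j))) Q := by
        rw [← coe_aeval_eq_eval, ← coe_aeval_eq_eval]
        change ((aeval x).comp (psi n)) Q = aeval _ Q
        congr 1
        apply MvPolynomial.algHom_ext
        rintro (⟨a, b⟩ | ⟨a, b⟩)
        · rw [AlgHom.comp_apply, psi, aeval_X, aeval_X]
          simp [pt]
        · rw [AlgHom.comp_apply, psi, aeval_X, aeval_X]
          simp [pt]
      rw [h3, h2, mul_zero]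
  exact (mul_eq_zero.mp h0).resolve_left (Matrix.det_mvPolynomialX_ne_zero _ _)

lemma mem_ideal (Q : MvPolynomial (WZVars n) ℂ) (h : psi n Q = 0) :
    Q ∈ Ideal.span (Set.range fun p : Fin n × Fin n => wz p.1 p.2) := by
  set I := Ideal.span (Set.range fun p : Fin n × Fin n => (wz p.1 p.2)) with hI
  let ι : MvPolynomial (Fin n × Fin n) ℂ →ₐ[ℂ] MvPolynomial (WZVars n) ℂ :=
    aeval (fun p => X (Sum.inl p))
  have : (Ideal.Quotient.mkₐ ℂ I).comp (ι.comp (psi n)) = Ideal.Quotient.mkₐ ℂ I := by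
    apply MvPolynomial.algHom_ext
    rintro (⟨a, b⟩ | ⟨a, b⟩)
    · simp only [AlgHom.comp_apply, psi, ι, aeval_X, Sum.elim_inl]
    · simp only [AlgHom.comp_apply, psi, ι, aeval_X, Sum.elim_inr, map_neg]
      rw [← sub_eq_zero, ← neg_eq_zero, neg_sub, sub_neg_eq_add, ← map_add, add_comm]
      exact Ideal.Quotient.eq_zero_iff_mem.mpr (Ideal.subset_span ⟨(a, b), rfl⟩)
  have h1 := DFunLike.congr_fun this Q
  rw [AlgHom.comp_apply, AlgHom.comp_apply, h, map_zero, map_zero] at h1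
  exact Ideal.Quotient.eq_zero_iff_mem.mp h1.symm

lemma fisch_ideal (P : MvPolynomial (XYVars n k₁ k₂) ℂ) (hP : Pluriharmonic P)
    (Q : MvPolynomial (WZVars n) ℂ)
    (h : Q ∈ Ideal.span (Set.range fun p : Fin n × Fin n => wz p.1 p.2)) :
    fisch (phi n k₁ k₂ Q) P = 0 := by
  suffices ∀ g, fisch (phi n k₁ k₂ Q * g) P = 0 by simpa using this 1
  induction h using Submodule.span_induction with
  | mem x hx =>
    obtain ⟨p, rfl⟩ := hx
    intro g
    simp only [fisch_wz, hP p.1 p.2, fisch_zero_right]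
  | zero => intro g; rw [map_zero, zero_mul, fisch_zero_left]
  | add x y _ _ hx hy => intro g; rw [map_add, add_mul, fisch_add_left, hx, hy, add_zero]
  | smul a x _ hx =>
    intro g
    rw [smul_eq_mul, map_mul, mul_comm (phi n k₁ k₂ a), mul_assoc, hx]

lemma uniq {v : ℕ} (hk₁ : n ≤ k₁) (hk₂ : n ≤ k₂) (Q : MvPolynomial (WZVars n) ℂ)
    (hQ : Q ∈ HSubspace n v k₁ k₂) (h : eval (pt 1) Q = 0) : Q = 0 := by
  apply phi_inj hk₁ hk₂
  rw [map_zero]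
  apply fisch_self_eq_zero
  have := fisch_ideal _ hQ.2 Q (mem_ideal Q (psi_zero Q hQ.1 h))
  rw [toP2_eq] at this
  rw [this, Complex.zero_re]

def detW (n : ℕ) : MvPolynomial (WZVars n) ℂ :=
  (Matrix.of fun s t : Fin n => (X (Sum.inl (s, t)) : MvPolynomial (WZVars n) ℂ)).det

lemma detW_mem (v : ℕ) : detW n ^ v ∈ QSub n v := by
  intro A B _ _
  have : substWZ A B (detW n) = C (A.det * B.det) * detW n := by
    rw [detW, AlgHom.map_det]
    have h : (substWZ A B).mapMatrix
        (Matrix.of fun s t : Fin n => (X (Sum.inl (s, t)) : MvPolynomial (WZVars n) ℂ)) =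
        (C.mapMatrix A) * (Matrix.of fun s t : Fin n => X (Sum.inl (s, t))) *
          (C.mapMatrix B).transpose := by
      ext1 s t
      simp only [AlgHom.mapMatrix_apply, Matrix.map_apply, Matrix.of_apply, substWZ, aeval_X,
        Sum.elim_inl, Matrix.mul_apply, RingHom.mapMatrix_apply, Matrix.transpose_apply,
        Finset.sum_mul, C_mul]
      rw [Finset.sum_comm]
      refine Finset.sum_congr rfl fun p _ => Finset.sum_congr rfl fun q _ => ?_
      ring
    rw [h, Matrix.det_mul, Matrix.det_mul, Matrix.det_transpose, ← RingHom.map_det,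
      ← RingHom.map_det, C_mul]
    ring
  rw [map_pow, this, mul_pow, ← C_pow, mul_pow]

lemma eval_detW (v : ℕ) : eval (pt (1 : Matrix (Fin n) (Fin n) ℂ)) (detW n ^ v) = 1 := by
  rw [map_pow, detW, RingHom.map_det]
  have : (eval (pt (1 : Matrix (Fin n) (Fin n) ℂ))).mapMatrix
    (Matrix.of fun s t : Fin n => (X (Sum.inl (s, t)) : MvPolynomial (WZVars n) ℂ)) = 1 := by
    ext s t; simp [pt]
  rw [this]; simp

lemma QSub_le (v : ℕ) : QSub n v ≤ restrictTotalDegree (WZVars n) ℂ (n * v) := by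
  classical
  intro Q hQ
  rw [mem_restrictTotalDegree]
  have h2 : ((2 : ℂ) • (1 : Matrix (Fin n) (Fin n) ℂ)).det = 2 ^ n := by simp
  have h := hQ ((2 : ℂ) • 1) 1 (by rw [h2]; simp) (by simp)
  rw [h2] at h
  have hs : ∀ m (c : ℂ), substWZ ((2 : ℂ) • 1) 1 (monomial m c : MvPolynomial (WZVars n) ℂ) =
      monomial m (c * 2 ^ (m.sum fun _ e => e)) := by
    intro m c
    have : substWZ ((2 : ℂ) • (1 : Matrix (Fin n) (Fin n) ℂ)) 1 = aeval (fun i => C 2 * X i) := by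
      rw [substWZ]
      congr 1
      funext i
      rcases i with ⟨a, b⟩ | ⟨a, b⟩ <;> simp [Matrix.one_apply, apply_ite C, ite_mul]
    rw [this, aeval_monomial, monomial_eq, algebraMap_eq, C_mul, mul_assoc]
    congr 1
    simp only [mul_pow, Finsupp.prod_mul, C_pow]
    congr 1
    rw [Finsupp.prod, Finset.prod_pow_eq_pow_sum]; rfl
  have hc : ∀ m, coeff m (substWZ ((2 : ℂ) • 1) 1 Q) = coeff m Q * 2 ^ (m.sum fun _ e => e) := by
    intro m
    clear h hQ
    induction Q using MvPolynomial.induction_on' with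
    | monomial m' c =>
      rw [hs, coeff_monomial, coeff_monomial]
      split_ifs with h
      · rw [h]
      · rw [zero_mul]
    | add p q hp hq => rw [map_add, coeff_add, coeff_add, hp, hq, add_mul]
  refine Finset.sup_le fun m hm => ?_
  have h3 := hc m
  rw [h, coeff_C_mul] at h3
  have h4 : (2 : ℂ) ^ (n * v) = 2 ^ (m.sum fun _ e => e) := by
    have := mem_support_iff.mp hm
    apply mul_right_cancel₀ this
    rw [mul_comm _ (coeff m Q), mul_comm _ (coeff m Q), ← h3]
    simp [pow_mul]; ring
  have h5 : (2 : ℕ) ^ (n * v) = 2 ^ (m.sum fun _ e => e) := by exact_mod_cast h4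
  exact (Nat.pow_right_injective le_rfl h5).symm.le

lemma exist {v : ℕ} (hk₁ : n ≤ k₁) (hk₂ : n ≤ k₂) :
    ∃ Q ∈ HSubspace n v k₁ k₂, Q ≠ 0 := by
  have : Module.Finite ℂ (QSub n v) := Submodule.finiteDimensional_of_le (QSub_le v)
  let E : QSub n v →ₗ[ℂ] QSub n v := (Eop k₁ k₂).restrict (Eop_mem hk₁ hk₂)
  have hns : ¬ Function.Surjective E := by
    intro hs
    obtain ⟨Q, hQ⟩ := hs ⟨detW n ^ v, detW_mem v⟩
    have h := congrArg (fun x : QSub n v => eval (pt 1) (x : MvPolynomial (WZVars n) ℂ)) hQ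
    simp only [eval_detW, E, LinearMap.restrict_apply, eval_Eop] at h
    exact zero_ne_one h
  rw [← LinearMap.injective_iff_surjective, ← LinearMap.ker_eq_bot, Submodule.eq_bot_iff] at hns
  push Not at hns
  obtain ⟨Q, hQ, hne⟩ := hns
  refine ⟨Q, ⟨Q.2, harm_of_Eop _ ?_⟩, fun h => hne (Subtype.ext h)⟩
  exact congrArg Subtype.val hQ

end
end helpers

/-- For `n ≥ 1`, `v > 0` and `k₁, k₂ ≥ n`, the space `H_{n,v}(k₁,k₂)` of pluriharmonic
polynomials inside `Q_{n,v}(2)` is one-dimensional over ℂ: up to rescaling there is a unique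
pluriharmonic polynomial in `Q_{n,v}(2)`. -/
theorem stmt3 (n v k₁ k₂ : ℕ) (hn : 1 ≤ n) (hv : 0 < v) (hk₁ : n ≤ k₁) (hk₂ : n ≤ k₂) :
    Module.finrank ℂ (HSubspace n v k₁ k₂) = 1 := by
  obtain ⟨Q, hQ, hne⟩ := exist (v := v) hk₁ hk₂
  have hQ1 : MvPolynomial.eval (pt 1) Q ≠ 0 := fun h => hne (uniq hk₁ hk₂ Q hQ h)
  refine finrank_eq_one (⟨Q, hQ⟩ : HSubspace n v k₁ k₂)
    (fun h => hne (congrArg Subtype.val h)) fun R => ?_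
  refine ⟨MvPolynomial.eval (pt 1) (R : MvPolynomial (WZVars n) ℂ) /
    MvPolynomial.eval (pt 1) Q, Subtype.ext ?_⟩
  rw [← sub_eq_zero]
  refine uniq hk₁ hk₂ _ (Submodule.sub_mem _ (Submodule.coe_mem _) R.2) ?_
  simp [MvPolynomial.smul_eval, hQ1]
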